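/- The function V₊ : (3/4, 1) → ℝ, q̃ ↦ v₊²(q̃), is strictly decreasing and maps the interval (3/4, 1) bijectively onto the interval (1/8, 1/2). In particular, v₊²(q̃) ∈ (1/8, 1/2) for every q̃ ∈ (3/4, 1). -/

import Mathlib

/-- `v₊²(q̃) = ((2q̃ − 1) − √(q̃(4q̃ − 3)))/(4(1 − q̃))`. -/
noncomputable def vplusSq (q : ℝ) : ℝ :=
  ((2 * q - 1) - Real.sqrt (q * (4 * q - 3))) / (4 * (1 - q))

/-- `v₋²(q̃) = ((2q̃ − 1) + √(q̃(4q̃ − 3)))/(4(1 − q̃))`. -/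
noncomputable def vminusSq (q : ℝ) : ℝ :=
  ((2 * q - 1) + Real.sqrt (q * (4 * q - 3))) / (4 * (1 - q))

/-- The inverse of `vplusSq`, sending a squared speed `v` to the parameter `q`. -/
noncomputable def vplusSqInv (v : ℝ) : ℝ :=
  (4 * v + 1) ^ 2 / (16 * v * (v + 1))

theorem vplusSq_mapsTo : Set.MapsTo vplusSq (Set.Ioo (3 / 4) 1) (Set.Ioo (1 / 8) (1 / 2)) := by
  rintro q ⟨hq₁, hq₂⟩
  have hden : 0 < 4 * (1 - q) := by linarith
  have hlower : 4 * q - 3 < √(q * (4 * q - 3)) := by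
    apply Real.lt_sqrt_of_sq_lt
    nlinarith
  have hupper : √(q * (4 * q - 3)) < (5 * q - 3) / 2 := by
    rw [Real.sqrt_lt' (by linarith)]
    nlinarith [mul_pos (sub_pos.2 hq₂) (sub_pos.2 hq₂)]
  constructor
  · rw [vplusSq, lt_div_iff₀ hden]
    linarith
  · rw [vplusSq, div_lt_iff₀ hden]
    linarith

theorem vplusSqInv_mapsTo :
    Set.MapsTo vplusSqInv (Set.Ioo (1 / 8) (1 / 2)) (Set.Ioo (3 / 4) 1) := by
  rintro v ⟨hv₁, hv₂⟩
  have hden : 0 < 16 * v * (v + 1) := by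
    have : 0 < v := by linarith
    positivity
  constructor
  · rw [vplusSqInv, lt_div_iff₀ hden]
    nlinarith [mul_pos (sub_pos.2 hv₂) (sub_pos.2 hv₂)]
  · rw [vplusSqInv, div_lt_one hden]
    linarith

theorem vplusSqInv_leftInvOn : Set.LeftInvOn vplusSqInv vplusSq (Set.Ioo (3 / 4) 1) := by
  intro q hq
  obtain ⟨hv, -⟩ := vplusSq_mapsTo hq
  obtain ⟨hq₁, hq₂⟩ := hq
  have hs : √(q * (4 * q - 3)) ^ 2 = q * (4 * q - 3) := Real.sq_sqrt (by nlinarith)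
  have hden : 4 * (1 - q) ≠ 0 := by linarith
  have hmul : vplusSq q * (4 * (1 - q)) = (2 * q - 1) - √(q * (4 * q - 3)) :=
    div_mul_cancel₀ _ hden
  have hroot : √(q * (4 * q - 3)) = (2 * q - 1) - vplusSq q * (4 * (1 - q)) := by linarith
  rw [hroot] at hs
  have hpos : 0 < vplusSq q := by linarith
  rw [vplusSqInv, div_eq_iff (by positivity)]
  apply mul_left_cancel₀ (sub_ne_zero.2 hq₂.ne')
  linear_combination hs

theorem vplusSqInv_rightInvOn : Set.RightInvOn vplusSqInv vplusSq (Set.Ioo (1 / 8) (1 / 2)) := by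
  rintro v ⟨hv₁, hv₂⟩
  have hv : 0 < v := by linarith
  have hv' : 0 < v + 1 := by linarith
  have hroot : √(vplusSqInv v * (4 * vplusSqInv v - 3)) =
      (4 * v + 1) * (1 - 2 * v) / (8 * v * (v + 1)) := by
    have hnonneg : 0 ≤ (4 * v + 1) * (1 - 2 * v) / (8 * v * (v + 1)) :=
      div_nonneg (mul_nonneg (by linarith) (by linarith)) (by positivity)
    rw [← Real.sqrt_sq hnonneg, vplusSqInv]
    congr 1
    field_simp
    ring
  have hsub : 1 - vplusSqInv v = (8 * v - 1) / (16 * v * (v + 1)) := by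
    rw [vplusSqInv]
    field_simp
    ring
  have hden : 0 < 8 * v - 1 := by linarith
  rw [vplusSq, hroot, hsub, vplusSqInv, div_eq_iff (by positivity)]
  field_simp
  ring

theorem vplusSqInv_antitoneOn : AntitoneOn vplusSqInv (Set.Ioo (1 / 8) (1 / 2)) := by
  rintro a ⟨ha₁, ha₂⟩ b ⟨hb₁, hb₂⟩ hab
  have ha : 0 < a := by linarith
  have hb : 0 < b := by linarith
  have hfactor : 0 ≤ 1 + a + b - 8 * a * b := by nlinarith
  rw [vplusSqInv, vplusSqInv, div_le_div_iff₀ (by positivity) (by positivity)]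
  linear_combination 16 * mul_nonneg (sub_nonneg.2 hab) hfactor

/-- `V₊ : q̃ ↦ v₊²(q̃)` is strictly decreasing on `(3/4, 1)` and maps `(3/4, 1)`
bijectively onto `(1/8, 1/2)`. -/
theorem vplusSq_strictAnti_bijOn :
    StrictAntiOn vplusSq (Set.Ioo (3 / 4) 1) ∧
    Set.BijOn vplusSq (Set.Ioo (3 / 4) 1) (Set.Ioo (1 / 8) (1 / 2)) := by
  refine ⟨fun p hp q hq hpq => ?_, Set.InvOn.bijOn ⟨vplusSqInv_leftInvOn, vplusSqInv_rightInvOn⟩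
    vplusSq_mapsTo vplusSqInv_mapsTo⟩
  by_contra! hle
  have := vplusSqInv_antitoneOn (vplusSq_mapsTo hp) (vplusSq_mapsTo hq) hle
  rw [vplusSqInv_leftInvOn hp, vplusSqInv_leftInvOn hq] at this
  exact hpq.not_ge this
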